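/- arXiv:1604.02339 — 4 statements merged into one kernel-verified Lean document; each statement's English description precedes it below -/
import Mathlib

section
/- Let φ, p, q : ℝ³ → ℝ be twice continuously differentiable and ℤ³-periodic (f(x + k) = f(x) for all k ∈ ℤ³), and set V := ∇φ + p·∇q. Then the total helicity over one period cell vanishes: ∫_{[0,1]³} ⟨V, curl V⟩ dx = 0. (Paper's Proposition 1: epi-2D flow on the 3-torus has zero helicity.) -/
open MeasureTheory

noncomputable section

/-- Points of ℝ³. -/
abbrev R3 := Fin 3 → ℝ

/-- Euclidean inner product on ℝ³. -/
def dot3 (u v : R3) : ℝ := ∑ i, u i * v i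

/-- Partial derivative ∂ᵢ of a scalar field on ℝ³. -/
def pd3 (i : Fin 3) (f : R3 → ℝ) (x : R3) : ℝ := fderiv ℝ f x (Pi.single i 1)

/-- Gradient of a scalar field on ℝ³. -/
def grad3 (f : R3 → ℝ) (x : R3) : R3 := fun i => pd3 i f x

/-- Divergence of a vector field on ℝ³. -/
def div3 (V : R3 → R3) (x : R3) : ℝ := ∑ i, pd3 i (fun y => V y i) x

/-- Curl of a vector field on ℝ³ (0-based indices). -/
def curl3 (V : R3 → R3) (x : R3) : R3 :=
  ![pd3 1 (fun y => V y 2) x - pd3 2 (fun y => V y 1) x,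
    pd3 2 (fun y => V y 0) x - pd3 0 (fun y => V y 2) x,
    pd3 0 (fun y => V y 1) x - pd3 1 (fun y => V y 0) x]

/-- Cross product on ℝ³. -/
def cross3 (u v : R3) : R3 :=
  ![u 1 * v 2 - u 2 * v 1, u 2 * v 0 - u 0 * v 2, u 0 * v 1 - u 1 * v 0]

/-- Determinant of the 3×3 matrix with columns u, v, w. -/
def det3 (u v w : R3) : ℝ := Matrix.det (Matrix.transpose (Matrix.of ![u, v, w]))

theorem pd3_add {f g : R3 → ℝ} {x : R3} (i : Fin 3) (hf : DifferentiableAt ℝ f x)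
    (hg : DifferentiableAt ℝ g x) :
    pd3 i (fun y => f y + g y) x = pd3 i f x + pd3 i g x := by
  simp only [pd3]
  rw [fderiv_fun_add hf hg]
  rfl

theorem pd3_sub {f g : R3 → ℝ} {x : R3} (i : Fin 3) (hf : DifferentiableAt ℝ f x)
    (hg : DifferentiableAt ℝ g x) :
    pd3 i (fun y => f y - g y) x = pd3 i f x - pd3 i g x := by
  simp only [pd3]
  rw [fderiv_fun_sub hf hg]
  rfl

theorem pd3_mul {f g : R3 → ℝ} {x : R3} (i : Fin 3) (hf : DifferentiableAt ℝ f x)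
    (hg : DifferentiableAt ℝ g x) :
    pd3 i (fun y => f y * g y) x = f x * pd3 i g x + pd3 i f x * g x := by
  simp only [pd3]
  rw [fderiv_fun_mul hf hg]
  simp [mul_comm]

theorem contDiff_pd3 {f : R3 → ℝ} (hf : ContDiff ℝ 2 f) (i : Fin 3) :
    ContDiff ℝ 1 (pd3 i f) :=
  (hf.fderiv_right (m := 1) (by norm_num)).clm_apply contDiff_const

/-- Mixed second partial derivatives of a `C²` scalar field commute. -/
theorem pd3_comm {f : R3 → ℝ} (hf : ContDiff ℝ 2 f) (i j : Fin 3) (x : R3) :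
    pd3 i (pd3 j f) x = pd3 j (pd3 i f) x := by
  have hd : DifferentiableAt ℝ (fderiv ℝ f) x :=
    (hf.fderiv_right (m := 1) (by norm_num)).differentiable one_ne_zero x
  have key : ∀ i j : Fin 3,
      pd3 i (pd3 j f) x = fderiv ℝ (fderiv ℝ f) x (Pi.single i 1) (Pi.single j 1) := by
    intro i j
    change fderiv ℝ (fun y => fderiv ℝ f y (Pi.single j 1)) x (Pi.single i 1) = _
    rw [fderiv_clm_apply hd (differentiableAt_const _)]
    simp
  rw [key, key]
  exact (hf.contDiffAt.isSymmSndFDerivAt (by simp)).eq _ _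

theorem pd3_add_period {f : R3 → ℝ} {a : R3} (hf : ∀ x, f (x + a) = f x) (i : Fin 3) (x : R3) :
    pd3 i f (x + a) = pd3 i f x := by
  simp only [pd3]
  rw [← fderiv_comp_add_right a, funext hf]

/-- The divergence of a `C¹` vector field on the 3-torus integrates to zero. -/
theorem integral_div3_eq_zero_of_periodic {W : R3 → R3} (hW : ∀ i, ContDiff ℝ 1 fun y => W y i)
    (hper : ∀ (x : R3) (k : Fin 3 → ℤ), W (x + fun i => (k i : ℝ)) = W x) :
    ∫ x in Set.Icc (0 : R3) 1, div3 W x = 0 := by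
  have hdiv := integral_divergence_of_hasFDerivAt_off_countable' (0 : R3) 1 zero_le_one
    (fun i y => W y i) (fun i => fderiv ℝ fun y => W y i) ∅ Set.countable_empty
    (fun i => (hW i).continuous.continuousOn)
    (fun x _ i => ((hW i).differentiable one_ne_zero x).hasFDerivAt)
    (Continuous.integrableOn_Icc (continuous_finsetSum _ fun i _ =>
      ((hW i).continuous_fderiv one_ne_zero).clm_apply continuous_const))
  refine hdiv.trans (Finset.sum_eq_zero fun i _ => sub_eq_zero.2 ?_)
  congr 1
  funext x
  have hface : (i.insertNth ((1 : R3) i) x : R3) =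
      i.insertNth ((0 : R3) i) x + fun j => ((Pi.single i 1 : Fin 3 → ℤ) j : ℝ) := by
    funext j
    refine Fin.succAboveCases i ?_ (fun j => ?_) j <;> simp
  rw [hface, hper]

/-- The helicity density of the flow `∇φ + p·∇q` is the divergence of `φ (∇p × ∇q)`. -/
theorem dot3_curl3_eq_div3 {φ p q : R3 → ℝ} (hφ : ContDiff ℝ 2 φ) (hp : ContDiff ℝ 2 p)
    (hq : ContDiff ℝ 2 q) (x : R3) :
    dot3 (grad3 φ x + p x • grad3 q x) (curl3 (fun y => grad3 φ y + p y • grad3 q y) x) =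
      div3 (fun y => φ y • cross3 (grad3 p y) (grad3 q y)) x := by
  have hφd : DifferentiableAt ℝ φ x := hφ.differentiable two_ne_zero x
  have hpd : DifferentiableAt ℝ p x := hp.differentiable two_ne_zero x
  have dφ : ∀ i, DifferentiableAt ℝ (pd3 i φ) x :=
    fun i => (contDiff_pd3 hφ i).differentiable one_ne_zero x
  have dp : ∀ i, DifferentiableAt ℝ (pd3 i p) x :=
    fun i => (contDiff_pd3 hp i).differentiable one_ne_zero x
  have dq : ∀ i, DifferentiableAt ℝ (pd3 i q) x :=
    fun i => (contDiff_pd3 hq i).differentiable one_ne_zero x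
  have hV : ∀ i j, pd3 i (fun y => pd3 j φ y + p y * pd3 j q y) x =
      pd3 i (pd3 j φ) x + (p x * pd3 i (pd3 j q) x + pd3 i p x * pd3 j q x) := fun i j => by
    rw [pd3_add i (dφ j) (hpd.fun_mul (dq j)), pd3_mul i hpd (dq j)]
  have hW : ∀ i j k, pd3 i (fun y => φ y * (pd3 j p y * pd3 k q y - pd3 k p y * pd3 j q y)) x =
      φ x * ((pd3 j p x * pd3 i (pd3 k q) x + pd3 i (pd3 j p) x * pd3 k q x) -
        (pd3 k p x * pd3 i (pd3 j q) x + pd3 i (pd3 k p) x * pd3 j q x)) +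
      pd3 i φ x * (pd3 j p x * pd3 k q x - pd3 k p x * pd3 j q x) := fun i j k => by
    rw [pd3_mul i hφd (((dp j).fun_mul (dq k)).fun_sub ((dp k).fun_mul (dq j))),
      pd3_sub i ((dp j).fun_mul (dq k)) ((dp k).fun_mul (dq j)), pd3_mul i (dp j) (dq k),
      pd3_mul i (dp k) (dq j)]
  simp only [dot3, div3, curl3, cross3, grad3, Fin.sum_univ_three, Pi.add_apply, Pi.smul_apply,
    smul_eq_mul, Matrix.cons_val_zero, Matrix.cons_val_one, Matrix.cons_val, hV, hW]
  rw [pd3_comm hφ 1 0, pd3_comm hφ 2 0, pd3_comm hφ 2 1, pd3_comm hp 1 0, pd3_comm hp 2 0,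
    pd3_comm hp 2 1, pd3_comm hq 1 0, pd3_comm hq 2 0, pd3_comm hq 2 1]
  ring

/-- Paper's Proposition 1: An epi-2D flow V = ∇φ + p·∇q on the 3-torus
(ℤ³-periodic fields, fundamental cell [0,1]³) has zero total helicity. -/
theorem epi2D_zero_helicity (φ p q : R3 → ℝ)
    (hφ : ContDiff ℝ 2 φ) (hp : ContDiff ℝ 2 p) (hq : ContDiff ℝ 2 q)
    (hφper : ∀ (x : R3) (k : Fin 3 → ℤ), φ (x + fun i => (k i : ℝ)) = φ x)
    (hpper : ∀ (x : R3) (k : Fin 3 → ℤ), p (x + fun i => (k i : ℝ)) = p x)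
    (hqper : ∀ (x : R3) (k : Fin 3 → ℤ), q (x + fun i => (k i : ℝ)) = q x) :
    ∫ x in Set.Icc (0 : R3) 1,
      dot3 (grad3 φ x + p x • grad3 q x)
           (curl3 (fun y => grad3 φ y + p y • grad3 q y) x) = 0 := by
  simp only [dot3_curl3_eq_div3 hφ hp hq]
  refine integral_div3_eq_zero_of_periodic (fun i => ?_) fun x k => ?_
  · have hφ1 : ContDiff ℝ 1 φ := hφ.of_le one_le_two
    have dp := contDiff_pd3 hp
    have dq := contDiff_pd3 hq
    have hcross : ∀ j k, ContDiff ℝ 1 fun y =>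
        φ y * (pd3 j p y * pd3 k q y - pd3 k p y * pd3 j q y) := fun j k =>
      hφ1.mul (((dp j).mul (dq k)).sub ((dp k).mul (dq j)))
    fin_cases i
    exacts [hcross 1 2, hcross 2 0, hcross 0 1]
  · have hgrad : ∀ f : R3 → ℝ, (∀ (x : R3) (k : Fin 3 → ℤ), f (x + fun i => (k i : ℝ)) = f x) →
        grad3 f (x + fun i => (k i : ℝ)) = grad3 f x := fun f hf =>
      funext fun i => pd3_add_period (fun y => hf y k) i x
    simp only [hφper, hgrad p hpper, hgrad q hqper]
end
end

section
/- Let V : ℝ × ℝ³ → ℝ³ be continuously differentiable, let p, q, r : ℝ × ℝ³ → ℝ be twice continuously differentiable and each advected by V (∂ₜf + ⟨V, ∇f⟩ = 0 for f ∈ {p, q, r}), and let ρ : ℝ × ℝ³ → ℝ be continuously differentiable, nowhere zero, and satisfy the continuity equation ∂ₜρ + div(ρV) = 0. Then the generalized potential vorticity ϑ(t,x) := det[∇p(t,x) | ∇q(t,x) | ∇r(t,x)] / ρ(t,x) is advected by V: ∂ₜϑ + ⟨V, ∇ϑ⟩ = 0 at every (t,x). -/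
open MeasureTheory

noncomputable section

/-- The generalized potential vorticity ϑ = det[∇p | ∇q | ∇r]/ρ of epi-2D flow. -/
def gpv (p q r ρ : ℝ × R3 → ℝ) (t : ℝ) (x : R3) : ℝ :=
  det3 (grad3 (fun y => p (t, y)) x) (grad3 (fun y => q (t, y)) x)
       (grad3 (fun y => r (t, y)) x) / ρ (t, x)

theorem pi_eq_sum_smul_single (v : R3) : v = ∑ i, v i • (Pi.single i 1 : R3) := by
  ext j
  simp [Finset.sum_apply, Pi.single_apply]

theorem deriv_time_slice {f : ℝ × R3 → ℝ} {t : ℝ} {x : R3}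
    (hf : DifferentiableAt ℝ f (t, x)) :
    deriv (fun s => f (s, x)) t = fderiv ℝ f (t, x) (1, 0) := by
  have h := hf.hasFDerivAt.comp_hasDerivAt t ((hasDerivAt_id t).prodMk (hasDerivAt_const t x))
  exact h.deriv

theorem pd3_space_slice {f : ℝ × R3 → ℝ} {t : ℝ} {x : R3} (i : Fin 3)
    (hf : DifferentiableAt ℝ f (t, x)) :
    pd3 i (fun y => f (t, y)) x = fderiv ℝ f (t, x) (0, Pi.single i 1) := by
  have h := hf.hasFDerivAt.comp x ((hasFDerivAt_const t x).prodMk (hasFDerivAt_id x))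
  have h' : fderiv ℝ (fun y => f (t, y)) x = _ := h.fderiv
  rw [pd3, h']
  rfl

theorem map_zero_prod_eq_sum (L : ℝ × R3 →L[ℝ] ℝ) (v : R3) :
    L (0, v) = ∑ j, v j * L (0, Pi.single j 1) := by
  have h := congrArg (L.comp (ContinuousLinearMap.inr ℝ ℝ R3)) (pi_eq_sum_smul_single v)
  simpa only [map_sum, map_smul, smul_eq_mul, ContinuousLinearMap.comp_apply,
    ContinuousLinearMap.inr_apply] using h

/-- The advection operator is the spacetime derivative in the direction `(1, v)`. -/
theorem deriv_add_dot3_grad3 {f : ℝ × R3 → ℝ} {t : ℝ} {x : R3} (v : R3)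
    (hf : DifferentiableAt ℝ f (t, x)) :
    deriv (fun s => f (s, x)) t + dot3 v (grad3 (fun y => f (t, y)) x)
      = fderiv ℝ f (t, x) (1, v) := by
  have hv : ((1 : ℝ), v) = (1, 0) + (0, v) := by simp
  rw [hv, map_add, map_zero_prod_eq_sum, deriv_time_slice hf]
  simp only [dot3, grad3, pd3_space_slice _ hf]

/-- The spatial part of the spacetime derivative. -/
def spaceGrad (f : ℝ × R3 → ℝ) (z : ℝ × R3) : R3 :=
  fun i => fderiv ℝ f z (0, Pi.single i 1)

theorem differentiable_spaceGrad {f : ℝ × R3 → ℝ} (hf : ContDiff ℝ 2 f) :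
    Differentiable ℝ (spaceGrad f) := by
  have h : Differentiable ℝ (fderiv ℝ f) :=
    (hf.fderiv_right (m := 1) (by norm_num)).differentiable (by norm_num)
  exact differentiable_pi.2 fun i => h.clm_apply (differentiable_const _)

/-- The gradient of an advected field is transported by the transposed velocity gradient. -/
theorem fderiv_spaceGrad_of_advected {V : ℝ × R3 → R3} {f : ℝ × R3 → ℝ}
    (hV : Differentiable ℝ V) (hf : ContDiff ℝ 2 f)
    (hadv : ∀ z, fderiv ℝ f z (1, V z) = 0) (z : ℝ × R3) (i : Fin 3) :
    fderiv ℝ (spaceGrad f) z (1, V z) i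
      = -∑ j, fderiv ℝ V z (0, Pi.single i 1) j * spaceGrad f z j := by
  have h : Differentiable ℝ (fderiv ℝ f) :=
    (hf.fderiv_right (m := 1) (by norm_num)).differentiable (by norm_num)
  have hsymm : IsSymmSndFDerivAt ℝ f z := hf.contDiffAt.isSymmSndFDerivAt (by simp)
  have h1 : fderiv ℝ (spaceGrad f) z (1, V z) i
      = fderiv ℝ (fderiv ℝ f) z (1, V z) (0, Pi.single i 1) := by
    have h2 : HasFDerivAt (spaceGrad f) (ContinuousLinearMap.pi fun i =>
        (fderiv ℝ (fderiv ℝ f) z).flip (0, Pi.single i 1)) z := by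
      refine hasFDerivAt_pi.2 fun i => ?_
      have := (h z).hasFDerivAt.clm_apply
        (hasFDerivAt_const ((0, Pi.single i 1) : ℝ × R3) z)
      simpa [spaceGrad] using this
    rw [h2.fderiv]
    simp
  have h3 := (h z).hasFDerivAt.clm_apply
    ((hasFDerivAt_const (1 : ℝ) z).prodMk (hV z).hasFDerivAt)
  have h4 : (fun w => fderiv ℝ f w (1, V w)) = fun _ => 0 := funext hadv
  rw [h4] at h3
  have h5 := congrArg (fun L => L ((0, Pi.single i 1) : ℝ × R3))
    (h3.unique (hasFDerivAt_const (0 : ℝ) z))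
  simp only [add_apply, ContinuousLinearMap.comp_apply,
    ContinuousLinearMap.prod_apply, ContinuousLinearMap.flip_apply,
    zero_apply] at h5
  rw [map_zero_prod_eq_sum] at h5
  rw [h1, hsymm.eq]
  simp only [spaceGrad]
  linarith

theorem div3_smul {V : ℝ × R3 → R3} {ρ : ℝ × R3 → ℝ} (hV : Differentiable ℝ V)
    (hρ : Differentiable ℝ ρ) (t : ℝ) (x : R3) :
    div3 (fun y => ρ (t, y) • V (t, y)) x = dot3 (V (t, x)) (grad3 (fun y => ρ (t, y)) x)
      + ρ (t, x) * ∑ i, fderiv ℝ V (t, x) (0, Pi.single i 1) i := by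
  have hVi : ∀ i, HasFDerivAt (fun z => V z i)
      ((ContinuousLinearMap.proj i).comp (fderiv ℝ V (t, x))) (t, x) := fun i =>
    hasFDerivAt_pi'.1 (hV (t, x)).hasFDerivAt i
  have h : ∀ i, pd3 i (fun y => (ρ (t, y) • V (t, y)) i) x
      = V (t, x) i * pd3 i (fun y => ρ (t, y)) x
        + ρ (t, x) * fderiv ℝ V (t, x) (0, Pi.single i 1) i := by
    intro i
    have hm := (hρ (t, x)).hasFDerivAt.mul (hVi i)
    have hs := pd3_space_slice i hm.differentiableAt
    rw [hm.fderiv] at hs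
    simp only [Pi.smul_apply, smul_eq_mul]
    refine hs.trans ?_
    rw [pd3_space_slice i (hρ (t, x))]
    simp
    ring
  simp only [div3, dot3, grad3, h, Finset.sum_add_distrib, Finset.mul_sum]

theorem det3_eq (u v w : R3) :
    det3 u v w = u 0 * (v 1 * w 2 - v 2 * w 1) - u 1 * (v 0 * w 2 - v 2 * w 0)
      + u 2 * (v 0 * w 1 - v 1 * w 0) := by
  rw [det3, Matrix.det_transpose, Matrix.det_fin_three]
  simp
  ring

theorem HasDerivAt.det3 {u v w : ℝ → R3} {u' v' w' : R3} {s : ℝ}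
    (hu : HasDerivAt u u' s) (hv : HasDerivAt v v' s) (hw : HasDerivAt w w' s) :
    HasDerivAt (fun s => det3 (u s) (v s) (w s))
      (det3 u' (v s) (w s) + det3 (u s) v' (w s) + det3 (u s) (v s) w') s := by
  rw [hasDerivAt_pi] at hu hv hw
  simp only [det3_eq]
  refine (((hu 0).mul (((hv 1).mul (hw 2)).sub ((hv 2).mul (hw 1)))).sub
    ((hu 1).mul (((hv 0).mul (hw 2)).sub ((hv 2).mul (hw 0)))) |>.add
    ((hu 2).mul (((hv 0).mul (hw 1)).sub ((hv 1).mul (hw 0))))).congr_deriv ?_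
  simp only [Pi.mul_apply, Pi.sub_apply]
  ring

theorem Differentiable.det3 {u v w : ℝ × R3 → R3} (hu : Differentiable ℝ u)
    (hv : Differentiable ℝ v) (hw : Differentiable ℝ w) :
    Differentiable ℝ (fun z => det3 (u z) (v z) (w z)) := by
  simp only [det3_eq]
  fun_prop

/-- A linear map acts on the determinant as a derivation through its trace. -/
theorem det3_derivation (A : Fin 3 → Fin 3 → ℝ) {u v w u' v' w' : R3}
    (hu : ∀ i, u' i = -∑ j, A i j * u j) (hv : ∀ i, v' i = -∑ j, A i j * v j)
    (hw : ∀ i, w' i = -∑ j, A i j * w j) :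
    det3 u' v w + det3 u v' w + det3 u v w' = -(∑ i, A i i) * det3 u v w := by
  simp only [det3_eq, hu, hv, hw, Fin.sum_univ_three]
  ring

/-- the generalized potential vorticity ϑ = det[∇p|∇q|∇r]/ρ is advected by V
when p, q, r are advected and ρ obeys the continuity equation (paper's Theorem 1). -/
theorem gpv_advected (V : ℝ × R3 → R3) (p q r ρ : ℝ × R3 → ℝ)
    (hV : ContDiff ℝ 1 V) (hp : ContDiff ℝ 2 p) (hq : ContDiff ℝ 2 q) (hr : ContDiff ℝ 2 r)
    (hρ : ContDiff ℝ 1 ρ) (hρne : ∀ (t : ℝ) (x : R3), ρ (t, x) ≠ 0)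
    (hadvp : ∀ (t : ℝ) (x : R3),
      deriv (fun s => p (s, x)) t + dot3 (V (t, x)) (grad3 (fun y => p (t, y)) x) = 0)
    (hadvq : ∀ (t : ℝ) (x : R3),
      deriv (fun s => q (s, x)) t + dot3 (V (t, x)) (grad3 (fun y => q (t, y)) x) = 0)
    (hadvr : ∀ (t : ℝ) (x : R3),
      deriv (fun s => r (s, x)) t + dot3 (V (t, x)) (grad3 (fun y => r (t, y)) x) = 0)
    (hcont : ∀ (t : ℝ) (x : R3),
      deriv (fun s => ρ (s, x)) t + div3 (fun y => ρ (t, y) • V (t, y)) x = 0) :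
    ∀ (t : ℝ) (x : R3),
      deriv (fun s => gpv p q r ρ s x) t
        + dot3 (V (t, x)) (grad3 (fun y => gpv p q r ρ t y) x) = 0 := by
  have hV' : Differentiable ℝ V := hV.differentiable (by norm_num)
  have hρ' : Differentiable ℝ ρ := hρ.differentiable (by norm_num)
  have hgrad : ∀ {f : ℝ × R3 → ℝ}, ContDiff ℝ 2 f → ∀ t x,
      grad3 (fun y => f (t, y)) x = spaceGrad f (t, x) := fun hf t x =>
    funext fun i => pd3_space_slice i (hf.differentiable (by norm_num) (t, x))
  have hadv : ∀ {f : ℝ × R3 → ℝ}, ContDiff ℝ 2 f →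
      (∀ t x, deriv (fun s => f (s, x)) t
        + dot3 (V (t, x)) (grad3 (fun y => f (t, y)) x) = 0) →
      ∀ z i, fderiv ℝ (spaceGrad f) z (1, V z) i
        = -∑ j, fderiv ℝ V z (0, Pi.single i 1) j * spaceGrad f z j := fun hf h =>
    fderiv_spaceGrad_of_advected hV' hf fun (z : ℝ × R3) =>
      (deriv_add_dot3_grad3 _ (hf.differentiable (by norm_num) z)).symm.trans (h z.1 z.2)
  intro t x
  set Θ : ℝ × R3 → ℝ := fun z =>
    det3 (spaceGrad p z) (spaceGrad q z) (spaceGrad r z) / ρ z with hΘ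
  have hgpv : ∀ s y, gpv p q r ρ s y = Θ (s, y) := fun s y => by
    simp only [gpv, hΘ, hgrad hp, hgrad hq, hgrad hr]
  have hΘd : Differentiable ℝ Θ := by
    simp only [hΘ, div_eq_mul_inv]
    exact (Differentiable.det3 (differentiable_spaceGrad hp) (differentiable_spaceGrad hq)
      (differentiable_spaceGrad hr)).fun_mul (hρ'.fun_inv fun z => hρne z.1 z.2)
  simp only [hgpv]
  rw [deriv_add_dot3_grad3 _ (hΘd (t, x))]
  set z : ℝ × R3 := (t, x) with hz
  have hline : HasDerivAt (fun s : ℝ => z + s • ((1, V z) : ℝ × R3)) (1, V z) 0 := by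
    simpa using ((hasDerivAt_id (0 : ℝ)).smul_const ((1, V z) : ℝ × R3)).const_add z
  have h0 : z = z + (0 : ℝ) • ((1, V z) : ℝ × R3) := by simp
  have along : ∀ {E : Type} [NormedAddCommGroup E] [NormedSpace ℝ E] {f : ℝ × R3 → E},
      Differentiable ℝ f →
      HasDerivAt (fun s : ℝ => f (z + s • ((1, V z) : ℝ × R3))) (fderiv ℝ f z (1, V z)) 0 :=
    fun hf => (hf z).hasFDerivAt.comp_hasDerivAt_of_eq 0 hline h0
  have hdet := HasDerivAt.det3 (along (differentiable_spaceGrad hp))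
    (along (differentiable_spaceGrad hq)) (along (differentiable_spaceGrad hr))
  rw [← h0, det3_derivation (fun i j => fderiv ℝ V z (0, Pi.single i 1) j)
    (hadv hp hadvp z) (hadv hq hadvq z) (hadv hr hadvr z)] at hdet
  have hquot := hdet.fun_div (along hρ') (by rw [← h0]; exact hρne t x)
  rw [← h0] at hquot
  rw [(along hΘd).unique hquot]
  have hc := hcont t x
  rw [div3_smul hV' hρ', ← add_assoc, deriv_add_dot3_grad3 _ (hρ' (t, x)), ← hz] at hc
  rw [eq_neg_of_add_eq_zero_left hc]
  ring
end
end

section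
/- (Clebsch parameterization solves the Euler equation.) Let φ, p, q : ℝ × ℝ³ → ℝ be twice continuously differentiable, let h : ℝ × ℝ³ → ℝ be continuously differentiable, and define V := ∇φ + p·∇q. Suppose that at every (t,x): ∂ₜφ + ⟨V, ∇φ⟩ = |V|²/2 − h (the Bernoulli-type Hamilton equation for φ), ∂ₜq + ⟨V, ∇q⟩ = 0, and ∂ₜp + ⟨V, ∇p⟩ = 0. Then V satisfies the barotropic momentum equation ∂ₜV + (V·∇)V = −∇h at every (t,x). -/
open MeasureTheory

noncomputable section

/-- Derivative of a scalar field along the fixed direction `v`. -/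
def dirDeriv {E : Type*} [NormedAddCommGroup E] [NormedSpace ℝ E] (v : E) (f : E → ℝ) (z : E) : ℝ :=
  fderiv ℝ f z v

section dirDeriv

variable {E : Type*} [NormedAddCommGroup E] [NormedSpace ℝ E] {f g : E → ℝ}

lemma dirDeriv_add (hf : Differentiable ℝ f) (hg : Differentiable ℝ g) (v z : E) :
    dirDeriv v (fun y => f y + g y) z = dirDeriv v f z + dirDeriv v g z := by
  simp [dirDeriv, fderiv_fun_add (hf z) (hg z)]

lemma dirDeriv_sub (hf : Differentiable ℝ f) (hg : Differentiable ℝ g) (v z : E) :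
    dirDeriv v (fun y => f y - g y) z = dirDeriv v f z - dirDeriv v g z := by
  simp [dirDeriv, fderiv_fun_sub (hf z) (hg z)]

lemma dirDeriv_mul (hf : Differentiable ℝ f) (hg : Differentiable ℝ g) (v z : E) :
    dirDeriv v (fun y => f y * g y) z = dirDeriv v f z * g z + f z * dirDeriv v g z := by
  simp [dirDeriv, fderiv_fun_mul (hf z) (hg z)]
  ring

lemma dirDeriv_sum {ι : Type*} (s : Finset ι) {F : ι → E → ℝ} (hF : ∀ i, Differentiable ℝ (F i))
    (v z : E) : dirDeriv v (fun y => ∑ i ∈ s, F i y) z = ∑ i ∈ s, dirDeriv v (F i) z := by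
  simp [dirDeriv, fderiv_fun_sum fun i _ => hF i z]

lemma ContDiff.differentiable_dirDeriv (hf : ContDiff ℝ 2 f) (v : E) :
    Differentiable ℝ (dirDeriv v f) :=
  ((hf.fderiv_right (m := 1) (by norm_num)).clm_apply contDiff_const).differentiable (by norm_num)

lemma dirDeriv_comm (hf : ContDiff ℝ 2 f) (u v z : E) :
    dirDeriv u (dirDeriv v f) z = dirDeriv v (dirDeriv u f) z := by
  have hd : DifferentiableAt ℝ (fderiv ℝ f) z :=
    (hf.fderiv_right (m := 1) (by norm_num)).differentiable (by norm_num) z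
  have key (a b : E) : dirDeriv a (dirDeriv b f) z = fderiv ℝ (fderiv ℝ f) z a b := by
    change fderiv ℝ (fun y => fderiv ℝ f y b) z a = _
    simp [fderiv_clm_apply hd (differentiableAt_const b)]
  rw [key, key]
  exact (hf.contDiffAt.isSymmSndFDerivAt (by simp)).eq u v

end dirDeriv

lemma pd3_slice {f : ℝ × R3 → ℝ} (hf : Differentiable ℝ f) (i : Fin 3) (t : ℝ) (x : R3) :
    pd3 i (fun y => f (t, y)) x = dirDeriv ((0 : ℝ), (Pi.single i 1 : R3)) f (t, x) := by
  have h : HasFDerivAt (fun y => f (t, y)) _ x :=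
    (hf (t, x)).hasFDerivAt.comp x (hasFDerivAt_prodMk_right t x)
  simp [pd3, dirDeriv, h.fderiv]

lemma hasDerivAt_slice {f : ℝ × R3 → ℝ} (hf : Differentiable ℝ f) (t : ℝ) (x : R3) :
    HasDerivAt (fun s => f (s, x)) (dirDeriv ((1 : ℝ), (0 : R3)) f (t, x)) t := by
  have h : HasFDerivAt (fun s => f (s, x)) _ t :=
    HasFDerivAt.comp (g := f) t (hf (t, x)).hasFDerivAt (hasFDerivAt_prodMk_left (𝕜 := ℝ) t x)
  simpa [dirDeriv] using h.hasDerivAt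

/-- Hamilton's equations for the Clebsch parameters (Bernoulli equation for φ,
advection of p and q) imply that V = ∇φ + p·∇q solves the barotropic momentum equation. -/
theorem clebsch_solves_euler (φ p q : ℝ × R3 → ℝ) (h : ℝ × R3 → ℝ)
    (hφ : ContDiff ℝ 2 φ) (hp : ContDiff ℝ 2 p) (hq : ContDiff ℝ 2 q)
    (hh : ContDiff ℝ 1 h)
    (V : ℝ × R3 → R3)
    (hVdef : ∀ (t : ℝ) (x : R3),
      V (t, x) = grad3 (fun y => φ (t, y)) x + p (t, x) • grad3 (fun y => q (t, y)) x)
    (hBern : ∀ (t : ℝ) (x : R3),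
      deriv (fun s => φ (s, x)) t + dot3 (V (t, x)) (grad3 (fun y => φ (t, y)) x)
        = dot3 (V (t, x)) (V (t, x)) / 2 - h (t, x))
    (hadvq : ∀ (t : ℝ) (x : R3),
      deriv (fun s => q (s, x)) t + dot3 (V (t, x)) (grad3 (fun y => q (t, y)) x) = 0)
    (hadvp : ∀ (t : ℝ) (x : R3),
      deriv (fun s => p (s, x)) t + dot3 (V (t, x)) (grad3 (fun y => p (t, y)) x) = 0) :
    ∀ (t : ℝ) (x : R3),
      deriv (fun s => V (s, x)) t
        + (fun i => dot3 (V (t, x)) (grad3 (fun y => V (t, y) i) x))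
        = -grad3 (fun y => h (t, y)) x := by
  have dφ : Differentiable ℝ φ := hφ.differentiable (by norm_num)
  have dp : Differentiable ℝ p := hp.differentiable (by norm_num)
  have dq : Differentiable ℝ q := hq.differentiable (by norm_num)
  have dh : Differentiable ℝ h := hh.differentiable (by norm_num)
  set e : Fin 3 → ℝ × R3 := fun i => (0, Pi.single i 1) with he
  set τ : ℝ × R3 := (1, 0)
  have hV (i : Fin 3) : (fun z => V z i) =
      fun z => dirDeriv (e i) φ z + p z * dirDeriv (e i) q z := by
    funext ⟨t, x⟩
    simp [hVdef, grad3, pd3_slice dφ, pd3_slice dq, he]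
  have dφ' (v : ℝ × R3) := hφ.differentiable_dirDeriv v
  have dq' (v : ℝ × R3) := hq.differentiable_dirDeriv v
  have dV (i : Fin 3) : Differentiable ℝ (fun z => V z i) := by
    rw [hV]
    exact (dφ' _).fun_add (dp.fun_mul (dq' _))
  have hDV (v z : ℝ × R3) (i : Fin 3) : dirDeriv v (fun y => V y i) z =
      dirDeriv v (dirDeriv (e i) φ) z + (dirDeriv v p z * dirDeriv (e i) q z
        + p z * dirDeriv v (dirDeriv (e i) q) z) := by
    rw [hV, dirDeriv_add (dφ' _) (dp.fun_mul (dq' _)), dirDeriv_mul dp (dq' _)]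
  have hBern' : (fun z => dirDeriv τ φ z + ∑ j, V z j * dirDeriv (e j) φ z) =
      fun z => (∑ j, V z j * V z j) * (1 / 2) - h z := by
    funext ⟨t, x⟩
    have := hBern t x
    simp only [(hasDerivAt_slice dφ t x).deriv, dot3, grad3, pd3_slice dφ] at this
    rw [this, div_eq_mul_one_div]
  have hadvq' : (fun z => dirDeriv τ q z + ∑ j, V z j * dirDeriv (e j) q z) = fun _ => 0 := by
    funext ⟨t, x⟩
    simpa only [(hasDerivAt_slice dq t x).deriv, dot3, grad3, pd3_slice dq] using hadvq t x
  intro t x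
  have hadvp' : dirDeriv τ p (t, x) + ∑ j, V (t, x) j * dirDeriv (e j) p (t, x) = 0 := by
    simpa only [(hasDerivAt_slice dp t x).deriv, dot3, grad3, pd3_slice dp] using hadvp t x
  have hVt : HasDerivAt (fun s => V (s, x))
      (fun i => dirDeriv τ (fun z => V z i) (t, x)) t :=
    hasDerivAt_pi.2 fun i => hasDerivAt_slice (dV i) t x
  ext i
  simp only [hVt.deriv, Pi.add_apply, Pi.neg_apply, dot3, grad3, pd3_slice (dV _), pd3_slice dh]
  change _ + ∑ j, V (t, x) j * dirDeriv (e j) (fun z => V z i) (t, x) =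
    -dirDeriv (e i) h (t, x)
  have hB := congrArg (fun F => dirDeriv (e i) F (t, x)) hBern'
  have hQ := congrArg (fun F => dirDeriv (e i) F (t, x)) hadvq'
  have dVφ (j : Fin 3) := (dV j).fun_mul (dφ' (e j))
  have dVq (j : Fin 3) := (dV j).fun_mul (dq' (e j))
  have dVV (j : Fin 3) := (dV j).fun_mul (dV j)
  have dVVsum : Differentiable ℝ (fun z => ∑ j, V z j * V z j) :=
    Differentiable.fun_sum fun j _ => dVV j
  beta_reduce at hB hQ
  rw [dirDeriv_add (dφ' τ) (Differentiable.fun_sum fun j _ => dVφ j),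
    dirDeriv_sub (dVVsum.fun_mul (differentiable_const _)) dh, dirDeriv_mul dVVsum (differentiable_const _),
    dirDeriv_sum _ dVφ, dirDeriv_sum _ dVV] at hB
  rw [dirDeriv_add (dq' τ) (Differentiable.fun_sum fun j _ => dVq j), dirDeriv_sum _ dVq] at hQ
  simp only [dirDeriv_mul (dV _) (dφ' _), dirDeriv_mul (dV _) (dV _)] at hB
  simp only [dirDeriv_mul (dV _) (dq' _)] at hQ
  have hconst (c : ℝ) : dirDeriv (e i) (fun _ => c) (t, x) = 0 := by simp [dirDeriv]
  rw [hconst] at hB hQ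
  have hW (j : Fin 3) := congrFun (hV j) (t, x)
  have cφ (v : ℝ × R3) := dirDeriv_comm hφ (e i) v (t, x)
  have cq (v : ℝ × R3) := dirDeriv_comm hq (e i) v (t, x)
  simp only [cφ, Fin.sum_univ_three] at hB
  simp only [cq, Fin.sum_univ_three] at hQ
  simp only [Fin.sum_univ_three] at hadvp' ⊢
  rw [hDV τ, hDV (e 0) _ i, hDV (e 1) _ i, hDV (e 2) _ i]
  linear_combination hB + p (t, x) * hQ + dirDeriv (e i) q (t, x) * hadvp'
    + dirDeriv (e i) (fun z => V z 0) (t, x) * hW 0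
    + dirDeriv (e i) (fun z => V z 1) (t, x) * hW 1
    + dirDeriv (e i) (fun z => V z 2) (t, x) * hW 2
end
end

section
/- (2D generalized enstrophy conservation.) Let v : ℝ × ℝ² → ℝ² be continuously differentiable, and let φ : ℝ × ℝ² → ℝ² be twice continuously differentiable with φ(0,x) = x, ∂ₜφ(t,x) = v(t, φ(t,x)) for all (t,x), and with φ(t,·) : ℝ² → ℝ² injective for each t. Let ρ, ω : ℝ × ℝ² → ℝ be continuously differentiable with ρ nowhere zero, satisfying ∂ₜρ + div(ρv) = 0 and ∂ₜω + div(ωv) = 0 at every (t,x). Let g : ℝ → ℝ be continuous and Σ ⊆ ℝ² be a measurable set such that x ↦ g(ω(0,x)/ρ(0,x))·ρ(0,x) is integrable on Σ. Then the generalized enstrophy Q(t) := ∫_{φ(t,·)(Σ)} g(ω(t,y)/ρ(t,y))·ρ(t,y) dy is defined and equals ∫_Σ g(ω(0,x)/ρ(0,x))·ρ(0,x) dx for every t; in particular Q is constant in t. -/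
open MeasureTheory

noncomputable section

/-- Points of ℝ². -/
abbrev R2 := Fin 2 → ℝ

/-- Euclidean inner product on ℝ². -/
def dot2 (u v : R2) : ℝ := ∑ i, u i * v i

/-- Partial derivative ∂ᵢ of a scalar field on ℝ². -/
def pd2 (i : Fin 2) (f : R2 → ℝ) (x : R2) : ℝ := fderiv ℝ f x (Pi.single i 1)

/-- Gradient of a scalar field on ℝ². -/
def grad2 (f : R2 → ℝ) (x : R2) : R2 := fun i => pd2 i f x

/-- Divergence of a vector field on ℝ². -/
def div2 (v : R2 → R2) (x : R2) : ℝ := ∑ i, pd2 i (fun y => v y i) x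

/-- Scalar vorticity ω = ∂₁v₂ − ∂₂v₁ of a 2D vector field (0-based indices). -/
def vort2 (v : R2 → R2) (x : R2) : ℝ :=
  pd2 0 (fun y => v y 1) x - pd2 1 (fun y => v y 0) x

/-- Along a flow of `v`, the spatial derivative of the flow map solves the linearized equation. -/
theorem hasDerivAt_fderiv_flow {v φ : ℝ × R2 → R2} (hv : ContDiff ℝ 1 v) (hφ : ContDiff ℝ 2 φ)
    (hflow : ∀ (t : ℝ) (x : R2), deriv (fun s => φ (s, x)) t = v (t, φ (t, x)))
    (x w : R2) (t : ℝ) :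
    HasDerivAt (fun s => fderiv ℝ φ (s, x) (0, w))
      (fderiv ℝ v (t, φ (t, x)) (0, fderiv ℝ φ (t, x) (0, w))) t := by
  have hφd : Differentiable ℝ φ := hφ.differentiable (by norm_num)
  have hF : Differentiable ℝ (fderiv ℝ φ) :=
    (hφ.fderiv_right (m := 1) (by norm_num)).differentiable (by norm_num)
  have htime : ∀ p : ℝ × R2, fderiv ℝ φ p (1, 0) = v (p.1, φ p) := by
    rintro ⟨s, y⟩
    have hline : HasDerivAt (fun r : ℝ => (r, y)) ((1 : ℝ), (0 : R2)) s :=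
      (hasDerivAt_id s).prodMk (hasDerivAt_const s y)
    rw [← hflow s y]
    exact ((hφd (s, y)).hasFDerivAt.comp_hasDerivAt s hline).deriv.symm
  have hline : HasDerivAt (fun r : ℝ => (r, x)) ((1 : ℝ), (0 : R2)) t :=
    (hasDerivAt_id t).prodMk (hasDerivAt_const t x)
  have hsymm : IsSymmSndFDerivAt ℝ φ (t, x) := hφ.contDiffAt.isSymmSndFDerivAt (by simp)
  have happly : ∀ u : ℝ × R2, HasFDerivAt (fun p => fderiv ℝ φ p u)
      ((ContinuousLinearMap.apply ℝ R2 u).comp (fderiv ℝ (fderiv ℝ φ) (t, x))) (t, x) := fun u =>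
    (ContinuousLinearMap.apply ℝ R2 u).hasFDerivAt.comp (t, x) (hF (t, x)).hasFDerivAt
  have hfield : HasFDerivAt (fun p : ℝ × R2 => v (p.1, φ p))
      ((fderiv ℝ v (t, φ (t, x))).comp
        ((ContinuousLinearMap.fst ℝ ℝ R2).prod (fderiv ℝ φ (t, x)))) (t, x) :=
    ((hv.differentiable (by norm_num)) (t, φ (t, x))).hasFDerivAt.comp (t, x)
      (hasFDerivAt_fst.prodMk (hφd (t, x)).hasFDerivAt)
  have htime' : HasFDerivAt (fun p => fderiv ℝ φ p (1, 0)) _ (t, x) := funext htime ▸ hfield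
  have hmixed := DFunLike.congr_fun ((happly (1, 0)).unique htime') ((0 : ℝ), w)
  refine ((happly (0, w)).comp_hasDerivAt t hline).congr_deriv ?_
  exact (hsymm.eq _ _).trans hmixed

theorem ContinuousLinearMap.det_R2 (A : R2 →L[ℝ] R2) :
    A.det = A (Pi.single 0 1) 0 * A (Pi.single 1 1) 1
      - A (Pi.single 1 1) 0 * A (Pi.single 0 1) 1 := by
  rw [ContinuousLinearMap.det, ← LinearMap.det_toMatrix', Matrix.det_fin_two]
  simp [LinearMap.toMatrix'_apply]

theorem ContinuousLinearMap.apply_R2 (B : R2 →L[ℝ] R2) (u : R2) (i : Fin 2) :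
    B u i = u 0 * B (Pi.single 0 1) i + u 1 * B (Pi.single 1 1) i := by
  have hu : u = u 0 • Pi.single 0 1 + u 1 • Pi.single 1 1 := by
    ext j; fin_cases j <;> simp
  conv_lhs => rw [hu]
  simp

theorem fderiv_slice {E : Type*} [NormedAddCommGroup E] [NormedSpace ℝ E] {f : ℝ × R2 → E}
    (hf : Differentiable ℝ f) (t : ℝ) (x : R2) :
    HasFDerivAt (fun y => f (t, y)) ((fderiv ℝ f (t, x)).comp (.inr ℝ ℝ R2)) x :=
  (hf (t, x)).hasFDerivAt.comp x (hasFDerivAt_prodMk_right t x)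

theorem div2_slice {v : ℝ × R2 → R2} (hv : Differentiable ℝ v) (t : ℝ) (x : R2) :
    div2 (fun y => v (t, y)) x = ∑ i, fderiv ℝ v (t, x) (0, Pi.single i 1) i := by
  refine Finset.sum_congr rfl fun i _ => ?_
  rw [pd2, (hasFDerivAt_pi'.1 (fderiv_slice hv t x) i).fderiv]
  simp

/-- Liouville's formula for the Jacobian determinant of a flow map. -/
theorem hasDerivAt_det_flow {v φ : ℝ × R2 → R2} (hv : ContDiff ℝ 1 v) (hφ : ContDiff ℝ 2 φ)
    (hflow : ∀ (t : ℝ) (x : R2), deriv (fun s => φ (s, x)) t = v (t, φ (t, x)))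
    (x : R2) (t : ℝ) :
    HasDerivAt (fun s => ((fderiv ℝ φ (s, x)).comp (.inr ℝ ℝ R2)).det)
      (div2 (fun y => v (t, y)) (φ (t, x)) * ((fderiv ℝ φ (t, x)).comp (.inr ℝ ℝ R2)).det) t := by
  have h : ∀ i j : Fin 2, HasDerivAt (fun s => fderiv ℝ φ (s, x) (0, Pi.single j 1) i)
      (fderiv ℝ v (t, φ (t, x)) (0, fderiv ℝ φ (t, x) (0, Pi.single j 1)) i) t := fun i j =>
    hasDerivAt_pi.1 (hasDerivAt_fderiv_flow hv hφ hflow x (Pi.single j 1) t) i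
  have hB : ∀ (u : R2) (i : Fin 2), fderiv ℝ v (t, φ (t, x)) (0, u) i =
      u 0 * fderiv ℝ v (t, φ (t, x)) (0, Pi.single 0 1) i
        + u 1 * fderiv ℝ v (t, φ (t, x)) (0, Pi.single 1 1) i := fun u i => by
    simpa using ((fderiv ℝ v (t, φ (t, x))).comp (.inr ℝ ℝ R2)).apply_R2 u i
  simp only [ContinuousLinearMap.det_R2, ContinuousLinearMap.comp_apply,
    ContinuousLinearMap.inr_apply]
  refine (((h 0 0).mul (h 1 1)).sub ((h 0 1).mul (h 1 0))).congr_deriv ?_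
  rw [div2_slice (hv.differentiable (by norm_num)), Fin.sum_univ_two]
  simp only [hB (fderiv ℝ φ (t, x) _)]
  ring

/-- A density transported by the continuity equation decays along the flow at the rate `div v`. -/
theorem hasDerivAt_density_flow {v φ : ℝ × R2 → R2} {ρ : ℝ × R2 → ℝ} (hv : ContDiff ℝ 1 v)
    (hφ : ContDiff ℝ 2 φ)
    (hflow : ∀ (t : ℝ) (x : R2), deriv (fun s => φ (s, x)) t = v (t, φ (t, x)))
    (hρ : ContDiff ℝ 1 ρ)
    (hcont : ∀ (t : ℝ) (x : R2),
      deriv (fun s => ρ (s, x)) t + div2 (fun y => ρ (t, y) • v (t, y)) x = 0)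
    (x : R2) (t : ℝ) :
    HasDerivAt (fun s => ρ (s, φ (s, x)))
      (-(ρ (t, φ (t, x)) * div2 (fun y => v (t, y)) (φ (t, x)))) t := by
  have hφd : Differentiable ℝ φ := hφ.differentiable (by norm_num)
  have hρd : Differentiable ℝ ρ := hρ.differentiable (by norm_num)
  have hvd : Differentiable ℝ v := hv.differentiable (by norm_num)
  have hpath : HasDerivAt (fun s => φ (s, x)) (v (t, φ (t, x))) t := by
    rw [← hflow t x]
    have : Differentiable ℝ fun s : ℝ => φ (s, x) := by fun_prop
    exact (this t).hasDerivAt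
  refine ((hρd (t, φ (t, x))).hasFDerivAt.comp_hasDerivAt t
    ((hasDerivAt_id t).prodMk hpath)).congr_deriv ?_
  have hc := hcont t (φ (t, x))
  generalize φ (t, x) = y at hc ⊢
  have htime : deriv (fun s => ρ (s, y)) t = fderiv ℝ ρ (t, y) (1, 0) :=
    ((hρd (t, y)).hasFDerivAt.comp_hasDerivAt t
      ((hasDerivAt_id t).prodMk (hasDerivAt_const t y))).deriv
  have hdiv : div2 (fun y => ρ (t, y) • v (t, y)) y =
      ρ (t, y) * div2 (fun y => v (t, y)) y + fderiv ℝ ρ (t, y) (0, v (t, y)) := by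
    have hprod := div2_slice (hρd.smul hvd) t y
    simp only [Pi.smul_apply'] at hprod
    rw [hprod, div2_slice hvd, fderiv_smul (hρd _) (hvd _)]
    have hlin : fderiv ℝ ρ (t, y) (0, v (t, y)) =
        v (t, y) 0 * fderiv ℝ ρ (t, y) (0, Pi.single 0 1)
          + v (t, y) 1 * fderiv ℝ ρ (t, y) (0, Pi.single 1 1) := by
      have hu : ((0 : ℝ), v (t, y)) = v (t, y) 0 • ((0 : ℝ), (Pi.single 0 1 : R2))
          + v (t, y) 1 • ((0 : ℝ), (Pi.single 1 1 : R2)) := by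
        ext j
        · simp
        · fin_cases j <;> simp
      conv_lhs => rw [hu]
      simp only [map_add, map_smul, smul_eq_mul]
    rw [hlin]
    simp [Fin.sum_univ_two]
    ring
  have hsplit : fderiv ℝ ρ (t, y) (1, v (t, y)) =
      fderiv ℝ ρ (t, y) (1, 0) + fderiv ℝ ρ (t, y) (0, v (t, y)) := by
    rw [← map_add]; simp
  rw [hsplit]
  rw [htime, hdiv] at hc
  linarith

/-- 2D generalized enstrophy conservation:
Q(t) = ∫_{φ(t,·)(Σ)} g(ω/ρ) ρ over a co-moving 2D domain is defined and constant. -/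
theorem generalized_enstrophy_conservation_2D
    (v : ℝ × R2 → R2) (φ : ℝ × R2 → R2) (ρ ω : ℝ × R2 → ℝ)
    (hv : ContDiff ℝ 1 v) (hφ : ContDiff ℝ 2 φ)
    (hφ0 : ∀ x : R2, φ (0, x) = x)
    (hflow : ∀ (t : ℝ) (x : R2), deriv (fun s => φ (s, x)) t = v (t, φ (t, x)))
    (hinj : ∀ t : ℝ, Function.Injective fun x => φ (t, x))
    (hρ : ContDiff ℝ 1 ρ) (hω : ContDiff ℝ 1 ω)
    (hρne : ∀ (t : ℝ) (x : R2), ρ (t, x) ≠ 0)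
    (hcontρ : ∀ (t : ℝ) (x : R2),
      deriv (fun s => ρ (s, x)) t + div2 (fun y => ρ (t, y) • v (t, y)) x = 0)
    (hcontω : ∀ (t : ℝ) (x : R2),
      deriv (fun s => ω (s, x)) t + div2 (fun y => ω (t, y) • v (t, y)) x = 0)
    (g : ℝ → ℝ) (hg : Continuous g)
    (S : Set R2) (hS : MeasurableSet S)
    (hint : IntegrableOn (fun x => g (ω (0, x) / ρ (0, x)) * ρ (0, x)) S volume) :
    ∀ t : ℝ,
      IntegrableOn (fun y => g (ω (t, y) / ρ (t, y)) * ρ (t, y))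
          ((fun x => φ (t, x)) '' S) volume
      ∧ ∫ y in (fun x => φ (t, x)) '' S, g (ω (t, y) / ρ (t, y)) * ρ (t, y)
          = ∫ x in S, g (ω (0, x) / ρ (0, x)) * ρ (0, x) := by
  intro t
  have hconst : ∀ f : ℝ → ℝ, (∀ s, HasDerivAt f 0 s) → f t = f 0 := fun f hf =>
    is_const_of_deriv_eq_zero (fun s => (hf s).differentiableAt) (fun s => (hf s).deriv) t 0
  set A : ℝ → R2 → R2 →L[ℝ] R2 := fun s x => (fderiv ℝ φ (s, x)).comp (.inr ℝ ℝ R2) with hA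
  have hAφ : ∀ s x, HasFDerivAt (fun y => φ (s, y)) (A s x) x :=
    fderiv_slice (hφ.differentiable (by norm_num))
  have hA0 : ∀ x, (A 0 x).det = 1 := fun x => by
    have : A 0 x = ContinuousLinearMap.id ℝ R2 :=
      (hAφ 0 x).unique ((hasFDerivAt_id x).congr_of_eventuallyEq (.of_forall hφ0))
    rw [this]
    simp [ContinuousLinearMap.det]
  have hmass : ∀ x, (A t x).det * ρ (t, φ (t, x)) = ρ (0, x) := fun x => by
    have := hconst (fun s => (A s x).det * ρ (s, φ (s, x))) fun s =>
      ((hasDerivAt_det_flow hv hφ hflow x s).mul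
        (hasDerivAt_density_flow hv hφ hflow hρ hcontρ x s)).congr_deriv (by ring)
    simpa [hA0, hφ0] using this
  have hpot : ∀ x, ω (t, φ (t, x)) / ρ (t, φ (t, x)) = ω (0, x) / ρ (0, x) := fun x => by
    have := hconst (fun s => ω (s, φ (s, x)) / ρ (s, φ (s, x))) fun s =>
      ((hasDerivAt_density_flow hv hφ hflow hω hcontω x s).div
        (hasDerivAt_density_flow hv hφ hflow hρ hcontρ x s) (hρne _ _)).congr_deriv (by ring)
    simpa [hφ0] using this
  have hpos : ∀ x, 0 < (A t x).det := fun x => by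
    by_contra! hle
    have hsame : ∀ p q : ℝ × R2, 0 < ρ p → 0 < ρ q := fun p q hp => by
      by_contra! hq
      obtain ⟨r, hr⟩ := mem_range_of_exists_le_of_exists_ge hρ.continuous ⟨q, hq⟩ ⟨p, hp.le⟩
      exact hρne r.1 r.2 hr
    rcases (hρne 0 x).lt_or_gt with h | h
    · have : ρ (t, φ (t, x)) ≤ 0 := by
        by_contra! h'
        exact (hsame _ (0, x) h').not_gt h
      nlinarith [hmass x]
    · nlinarith [hmass x, hsame _ (t, φ (t, x)) h]
  have hdens : (fun x => |(A t x).det| •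
      (g (ω (t, φ (t, x)) / ρ (t, φ (t, x))) * ρ (t, φ (t, x)))) =
      fun x => g (ω (0, x) / ρ (0, x)) * ρ (0, x) := by
    ext x
    rw [abs_of_pos (hpos x), hpot, ← hmass x, smul_eq_mul]
    ring
  have hderiv : ∀ x ∈ S, HasFDerivWithinAt (fun y => φ (t, y)) (A t x) S x :=
    fun x _ => (hAφ t x).hasFDerivWithinAt
  constructor
  · rw [integrableOn_image_iff_integrableOn_abs_det_fderiv_smul volume hS hderiv (hinj t).injOn,
      hdens]
    exact hint
  · rw [integral_image_eq_integral_abs_det_fderiv_smul volume hS hderiv (hinj t).injOn, hdens]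
end
end
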